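/- arXiv:2005.11990 — 4 statements merged into one kernel-verified Lean document; each statement's English description precedes it below -/
import Mathlib

section
/- Let G be a nonempty open proper subset of ℝⁿ (n ≥ 1). Then for all x, y ∈ G, the inequality p_G(x,y)/√2 ≤ s_G(x,y) ≤ √2·p_G(x,y) holds. -/
open Set Metric

/-- Distance from `x` to the boundary of `G`. -/
noncomputable def distBd {n : ℕ} (G : Set (EuclideanSpace ℝ (Fin n)))
    (x : EuclideanSpace ℝ (Fin n)) : ℝ :=
  Metric.infDist x (frontier G)

/-- The triangular ratio metric `s_G`. -/
noncomputable def triRatio {n : ℕ} (G : Set (EuclideanSpace ℝ (Fin n)))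
    (x y : EuclideanSpace ℝ (Fin n)) : ℝ :=
  dist x y / sInf ((fun z => dist x z + dist z y) '' frontier G)

/-- The point pair function `p_G`. -/
noncomputable def pointPair {n : ℕ} (G : Set (EuclideanSpace ℝ (Fin n)))
    (x y : EuclideanSpace ℝ (Fin n)) : ℝ :=
  dist x y / Real.sqrt (dist x y ^ 2 + 4 * distBd G x * distBd G y)

/-- The infimum defining `triRatio` is at most `dist x y + 2 * distBd G x`. -/
lemma sInf_dist_add_dist_le {n : ℕ} {G : Set (EuclideanSpace ℝ (Fin n))}
    (hG : (frontier G).Nonempty) (x y : EuclideanSpace ℝ (Fin n)) :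
    sInf ((fun z => dist x z + dist z y) '' frontier G) ≤ dist x y + 2 * distBd G x := by
  obtain ⟨z, hz, hxz⟩ := isClosed_frontier.exists_infDist_eq_dist hG x
  have hbdd : BddBelow ((fun z => dist x z + dist z y) '' frontier G) :=
    ⟨0, by rintro _ ⟨w, -, rfl⟩; positivity⟩
  refine (csInf_le hbdd ⟨z, hz, rfl⟩).trans ?_
  have h := dist_triangle z x y
  rw [dist_comm z x] at h
  simp only [distBd, hxz]
  linarith

/-- The infimum defining `triRatio` is symmetric in the two points. -/
lemma sInf_dist_add_dist_comm {n : ℕ} (G : Set (EuclideanSpace ℝ (Fin n)))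
    (x y : EuclideanSpace ℝ (Fin n)) :
    sInf ((fun z => dist x z + dist z y) '' frontier G) =
      sInf ((fun z => dist y z + dist z x) '' frontier G) := by
  simp only [dist_comm x, dist_comm y, add_comm]

/-- The infimum defining `triRatio` is at least `dist x y`. -/
lemma dist_le_sInf_dist_add_dist {n : ℕ} {G : Set (EuclideanSpace ℝ (Fin n))}
    (hG : (frontier G).Nonempty) (x y : EuclideanSpace ℝ (Fin n)) :
    dist x y ≤ sInf ((fun z => dist x z + dist z y) '' frontier G) := by
  refine le_csInf (hG.image _) ?_
  rintro _ ⟨z, -, rfl⟩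
  exact dist_triangle x z y

/-- The infimum defining `triRatio` is at least `distBd G x + distBd G y`. -/
lemma distBd_add_distBd_le_sInf_dist_add_dist {n : ℕ} {G : Set (EuclideanSpace ℝ (Fin n))}
    (hG : (frontier G).Nonempty) (x y : EuclideanSpace ℝ (Fin n)) :
    distBd G x + distBd G y ≤ sInf ((fun z => dist x z + dist z y) '' frontier G) := by
  refine le_csInf (hG.image _) ?_
  rintro _ ⟨z, hz, rfl⟩
  have hy := infDist_le_dist_of_mem (x := y) hz
  rw [dist_comm] at hy
  exact add_le_add (infDist_le_dist_of_mem hz) hy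

theorem stmt_0 (n : ℕ) (hn : 1 ≤ n) (G : Set (EuclideanSpace ℝ (Fin n)))
    (hne : G.Nonempty) (hopen : IsOpen G) (hproper : G ≠ univ) :
    ∀ x ∈ G, ∀ y ∈ G,
      pointPair G x y / Real.sqrt 2 ≤ triRatio G x y ∧
      triRatio G x y ≤ Real.sqrt 2 * pointPair G x y := by
  intro x _ y _
  have hG : (frontier G).Nonempty := nonempty_frontier_iff.2 ⟨hne, hproper⟩
  have hSx := sInf_dist_add_dist_le hG x y
  have hSy := sInf_dist_add_dist_le hG y x
  rw [← sInf_dist_add_dist_comm, dist_comm y x] at hSy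
  have hdS := dist_le_sInf_dist_add_dist hG x y
  have habS := distBd_add_distBd_le_sInf_dist_add_dist hG x y
  have ha : 0 ≤ distBd G x := infDist_nonneg
  have hb : 0 ≤ distBd G y := infDist_nonneg
  have hd : 0 ≤ dist x y := dist_nonneg
  unfold pointPair triRatio
  generalize sInf ((fun z => dist x z + dist z y) '' frontier G) = S at *
  generalize distBd G x = a at *
  generalize distBd G y = b at *
  generalize dist x y = d at *
  obtain rfl | hd := hd.eq_or_lt
  · simp
  have hS : 0 < S := hd.trans_le hdS
  have hab : 0 ≤ a * b := mul_nonneg ha hb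
  have hP : 0 < d ^ 2 + 4 * a * b := by nlinarith
  have hlower : S ≤ √2 * √(d ^ 2 + 4 * a * b) := by
    rw [← Real.sqrt_mul zero_le_two]
    apply Real.le_sqrt_of_sq_le
    obtain h | h := le_total a b
    · nlinarith [sq_nonneg (d - 2 * a), mul_le_mul_of_nonneg_left h ha]
    · nlinarith [sq_nonneg (d - 2 * b), mul_le_mul_of_nonneg_left h hb]
  have hupper : √(d ^ 2 + 4 * a * b) ≤ √2 * S := by
    rw [Real.sqrt_le_left (by positivity), mul_pow, Real.sq_sqrt zero_le_two]
    nlinarith [sq_nonneg (a - b)]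
  constructor
  · rw [div_div]
    apply div_le_div_of_nonneg_left hd.le hS
    rwa [mul_comm]
  · rw [← mul_div_assoc, div_le_div_iff₀ hS (Real.sqrt_pos.2 hP)]
    calc d * √(d ^ 2 + 4 * a * b) ≤ d * (√2 * S) := by gcongr
      _ = √2 * d * S := by ring
end

section
/- Let G be a nonempty open connected proper subset of ℝⁿ. Then G is convex if and only if the inequality s_G(x,y) ≤ p_G(x,y) holds for all x, y ∈ G. -/
open Set Metric

theorem exists_mem_segment_inter_frontier {E : Type*} [NormedAddCommGroup E] [NormedSpace ℝ E]
    {G : Set E} {x y : E} (hx : x ∈ G) (hy : y ∉ G) : ∃ w ∈ segment ℝ x y, w ∈ frontier G := by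
  by_contra! h
  have hc : IsPreconnected (segment ℝ x y) := (convex_segment x y).isPreconnected
  obtain ⟨w, -, hwi, hwc⟩ := hc (interior G) (closure G)ᶜ isOpen_interior
    isClosed_closure.isOpen_compl
    (fun w hw => by
      by_contra hw'
      rw [mem_union, not_or, notMem_compl_iff] at hw'
      exact h w hw ⟨hw'.2, hw'.1⟩)
    ⟨x, left_mem_segment ℝ x y, by
      by_contra hx'
      exact h x (left_mem_segment ℝ x y) ⟨subset_closure hx, hx'⟩⟩
    ⟨y, right_mem_segment ℝ x y, fun hy' =>
      h y (right_mem_segment ℝ x y) ⟨hy', fun hyi => hy (interior_subset hyi)⟩⟩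
  exact hwc (interior_subset_closure hwi)

theorem infDist_frontier_le_dist {E : Type*} [NormedAddCommGroup E] [NormedSpace ℝ E]
    {G : Set E} {x y : E} (hx : x ∈ G) (hy : y ∉ G) : infDist x (frontier G) ≤ dist x y := by
  obtain ⟨w, hw, hwf⟩ := exists_mem_segment_inter_frontier hx hy
  refine (infDist_le_dist_of_mem hwf).trans ?_
  linarith [dist_add_dist_of_mem_segment hw, dist_nonneg (x := w) (y := y)]

/-- The path from `x` to `y` through `z` is at least as long as the segment from `x` to the
reflection of `y` in the hyperplane through `z` with unit normal `u`. -/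
theorem dist_sq_add_four_mul_inner_mul_inner_le {E : Type*} [NormedAddCommGroup E]
    [InnerProductSpace ℝ E] (x y z u : E) (hu : ‖u‖ = 1) :
    dist x y ^ 2 + 4 * inner ℝ (z - x) u * inner ℝ (z - y) u ≤ (dist x z + dist z y) ^ 2 := by
  have h1 : dist x z = ‖z - x‖ := by rw [dist_comm, dist_eq_norm]
  have h2 : dist x y = ‖(z - x) - (z - y)‖ := by
    rw [dist_comm, dist_eq_norm]; congr 1; abel
  rw [h1, h2, dist_eq_norm z y]
  generalize z - x = p
  generalize z - y = q
  have hr : ‖q - (2 * inner ℝ q u) • u‖ = ‖q‖ := by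
    rw [← sq_eq_sq₀ (norm_nonneg _) (norm_nonneg _), norm_sub_sq_real, norm_smul, hu,
      real_inner_smul_right, Real.norm_eq_abs, mul_one, sq_abs]
    ring
  have hs := norm_sub_le p (q - (2 * inner ℝ q u) • u)
  rw [hr] at hs
  refine le_trans (le_of_eq ?_) (pow_le_pow_left₀ (norm_nonneg _) hs 2)
  rw [norm_sub_sq_real, norm_sub_sq_real p (q - _), hr, inner_sub_right, real_inner_smul_right]
  ring

theorem Convex.exists_unit_normal_infDist_le {E : Type*} [NormedAddCommGroup E]
    [InnerProductSpace ℝ E] [CompleteSpace E] {G : Set E} (hG : Convex ℝ G) (hopen : IsOpen G)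
    (hne : G.Nonempty) {z : E} (hz : z ∉ G) :
    ∃ u : E, ‖u‖ = 1 ∧ ∀ x ∈ G, infDist x (frontier G) ≤ inner ℝ (z - x) u := by
  obtain ⟨f, hf⟩ := geometric_hahn_banach_open_point hG hopen hz
  set v := (InnerProductSpace.toDual ℝ E).symm f with hv
  have hfv : ∀ w, f w = inner ℝ v w := fun w => by
    rw [hv, InnerProductSpace.toDual_symm_apply]
  have hv0 : v ≠ 0 := by
    intro h0
    obtain ⟨x, hx⟩ := hne
    have := hf x hx
    simp [hfv, h0] at this
  have hvn : ‖v‖ ≠ 0 := norm_ne_zero_iff.mpr hv0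
  have hu : ‖‖v‖⁻¹ • v‖ = 1 := norm_smul_inv_norm hv0
  refine ⟨‖v‖⁻¹ • v, hu, fun x hx => ?_⟩
  have hpos : 0 ≤ inner ℝ (z - x) (‖v‖⁻¹ • v) := by
    have := hf x hx
    rw [real_inner_smul_right, real_inner_comm, ← hfv, map_sub]
    exact mul_nonneg (by positivity) (by linarith)
  have hout : x + inner ℝ (z - x) (‖v‖⁻¹ • v) • (‖v‖⁻¹ • v) ∉ G := by
    intro hmem
    refine (hf _ hmem).ne ?_
    have hzx : inner ℝ (z - x) v = f z - f x := by rw [real_inner_comm, ← hfv, map_sub]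
    rw [map_add, map_smul, map_smul, hfv v, real_inner_self_eq_norm_sq, real_inner_smul_right,
      hzx, smul_eq_mul, smul_eq_mul]
    field_simp
    ring
  refine (infDist_frontier_le_dist hx hout).trans (le_of_eq ?_)
  rw [dist_self_add_right, norm_smul, hu, mul_one, Real.norm_of_nonneg hpos]

theorem stmt_1 (n : ℕ) (G : Set (EuclideanSpace ℝ (Fin n)))
    (hne : G.Nonempty) (hopen : IsOpen G) (hconn : IsConnected G) (hproper : G ≠ univ) :
    Convex ℝ G ↔ ∀ x ∈ G, ∀ y ∈ G, triRatio G x y ≤ pointPair G x y := by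
  have hfr : (frontier G).Nonempty := nonempty_frontier_iff.mpr ⟨hne, hproper⟩
  have hd : ∀ x ∈ G, 0 < distBd G x := fun x hx =>
    (isClosed_frontier.notMem_iff_infDist_pos hfr).mp
      fun h => (hopen.frontier_eq ▸ h).2 hx
  constructor
  · intro hG x hx y hy
    have hpos : 0 < dist x y ^ 2 + 4 * distBd G x * distBd G y := by
      have := hd x hx
      have := hd y hy
      positivity
    refine div_le_div_of_nonneg_left dist_nonneg (Real.sqrt_pos.mpr hpos)
      (le_csInf (hfr.image _) ?_)
    rintro _ ⟨z, hz, rfl⟩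
    obtain ⟨u, hu, hle⟩ := hG.exists_unit_normal_infDist_le hopen hne
      (hopen.frontier_eq ▸ hz).2
    refine Real.sqrt_le_iff.mpr ⟨by positivity, ?_⟩
    refine le_trans ?_ (dist_sq_add_four_mul_inner_mul_inner_le x y z u hu)
    have := mul_le_mul (hle x hx) (hle y hy) (hd y hy).le ((hd x hx).le.trans (hle x hx))
    unfold distBd
    linarith
  · intro h
    refine convex_iff_segment_subset.mpr fun x hx y hy w hw => ?_
    by_contra hwG
    obtain ⟨z, hzw, hz⟩ := exists_mem_segment_inter_frontier hx hwG
    have hzs : z ∈ segment ℝ x y :=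
      (convex_segment x y).segment_subset (left_mem_segment ℝ x y) hw hzw
    have hdx := hd x hx
    have hdy := hd y hy
    have hxy : 0 < dist x y := by
      refine dist_pos.mpr ?_
      rintro rfl
      rw [segment_same, mem_singleton_iff] at hw
      exact hwG (hw ▸ hx)
    have hlow : ∀ t ∈ (fun z => dist x z + dist z y) '' frontier G, distBd G x ≤ t := by
      rintro _ ⟨t, ht, rfl⟩
      exact (infDist_le_dist_of_mem ht).trans (le_add_of_nonneg_right dist_nonneg)
    have hinf_pos := hdx.trans_le (le_csInf (hfr.image _) hlow)
    have hinf_le : sInf ((fun z => dist x z + dist z y) '' frontier G) ≤ dist x y :=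
      csInf_le ⟨_, hlow⟩ ⟨z, hz, dist_add_dist_of_mem_segment hzs⟩
    have hs : 1 ≤ triRatio G x y := (one_le_div hinf_pos).mpr hinf_le
    have hlt : dist x y < √(dist x y ^ 2 + 4 * distBd G x * distBd G y) :=
      Real.lt_sqrt_of_sq_lt (lt_add_of_pos_right _ (by positivity))
    have hp : pointPair G x y < 1 := (div_lt_one (hxy.trans hlt)).mpr hlt
    exact (hs.trans (h x hx y hy)).not_gt hp
end

section
/- For any nonempty open connected proper subset G of ℝⁿ, there exist distinct points x, y ∈ G such that s_G(x,y) = j*_G(x,y) = p_G(x,y). -/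
open Set Metric

/-- The `j*`-metric. -/
noncomputable def jStar {n : ℕ} (G : Set (EuclideanSpace ℝ (Fin n)))
    (x y : EuclideanSpace ℝ (Fin n)) : ℝ :=
  dist x y / (dist x y + 2 * min (distBd G x) (distBd G y))

/-- A ball whose radius is the distance from a point of an open set to its boundary lies in the
set. -/
lemma ball_infDist_frontier_subset {E : Type*} [NormedAddCommGroup E] [NormedSpace ℝ E]
    {G : Set E} (hG : IsOpen G) {y : E} (hy : y ∈ G) :
    ball y (infDist y (frontier G)) ⊆ G := by
  rcases le_or_gt (infDist y (frontier G)) 0 with h | h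
  · simp [ball_eq_empty.2 h]
  refine (convex_ball y _).isPreconnected.subset_left_of_subset_union hG
    (isClosed_closure (s := G)).isOpen_compl ?_ ?_ ⟨y, mem_ball_self h, hy⟩
  · exact disjoint_compl_right.mono_left subset_closure
  · intro w hw
    by_contra hc
    simp only [mem_union, mem_compl_iff, not_or, not_not] at hc
    have hwf : w ∈ frontier G := by
      rw [hG.frontier_eq]
      exact ⟨hc.2, hc.1⟩
    have := infDist_le_dist_of_mem (x := y) hwf
    rw [mem_ball'] at hw
    linarith

theorem stmt_2 (n : ℕ) (G : Set (EuclideanSpace ℝ (Fin n)))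
    (hne : G.Nonempty) (hopen : IsOpen G) (hconn : IsConnected G) (hproper : G ≠ univ) :
    ∃ x ∈ G, ∃ y ∈ G, x ≠ y ∧
      triRatio G x y = jStar G x y ∧ jStar G x y = pointPair G x y := by
  obtain ⟨y, hy⟩ := hne
  have hfr : (frontier G).Nonempty := nonempty_frontier_iff.2 ⟨⟨y, hy⟩, hproper⟩
  obtain ⟨z, hz, hyz⟩ := isClosed_frontier.exists_infDist_eq_dist hfr y
  have hzG : z ∉ G := by
    rw [hopen.frontier_eq] at hz
    exact hz.2
  set M := dist y z with hM
  have hMpos : 0 < M := dist_pos.2 fun h => hzG (h ▸ hy)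
  set x := midpoint ℝ y z with hx
  have hxy : dist x y = M / 2 := by
    rw [hx, dist_midpoint_left, Real.norm_ofNat]; ring
  have hxz : dist x z = M / 2 := by
    rw [hx, dist_midpoint_right, Real.norm_ofNat]; ring
  have hxG : x ∈ G := by
    apply ball_infDist_frontier_subset hopen hy
    rw [mem_ball, hyz, hxy]
    linarith
  have hdy : distBd G y = M := hyz
  have hdx : distBd G x = M / 2 := by
    have h₁ : infDist x (frontier G) ≤ dist x z := infDist_le_dist_of_mem hz
    have h₂ : infDist y (frontier G) ≤ infDist x (frontier G) + dist y x :=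
      infDist_le_infDist_add_dist
    rw [dist_comm y x] at h₂
    unfold distBd
    linarith
  have hinf : sInf ((fun w => dist x w + dist w y) '' frontier G) = 3 * M / 2 := by
    refine IsLeast.csInf_eq ⟨⟨z, hz, ?_⟩, ?_⟩
    · change dist x z + dist z y = 3 * M / 2
      rw [dist_comm z y, hxz]; ring
    · rintro _ ⟨w, hw, rfl⟩
      have h₁ : distBd G x ≤ dist x w := infDist_le_dist_of_mem hw
      have h₂ : distBd G y ≤ dist y w := infDist_le_dist_of_mem hw
      change 3 * M / 2 ≤ dist x w + dist w y
      rw [dist_comm w y]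
      linarith
  have hsqrt : Real.sqrt ((M / 2) ^ 2 + 4 * (M / 2) * M) = 3 * M / 2 := by
    rw [show (M / 2) ^ 2 + 4 * (M / 2) * M = (3 * M / 2) ^ 2 by ring]
    exact Real.sqrt_sq (by positivity)
  have hmin : min (M / 2) M = M / 2 := min_eq_left (by linarith)
  have hj : jStar G x y = M / 2 / (3 * M / 2) := by
    rw [jStar, hxy, hdx, hdy, hmin]
    congr 1
    ring
  refine ⟨x, hxG, y, hy, ?_, ?_, ?_⟩
  · rw [← dist_pos, hxy]
    positivity
  · rw [hj, triRatio, hinf, hxy]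
  · rw [hj, pointPair, hxy, hdx, hdy, hsqrt]
end

section
/- For all t ∈ (0,1) and all real numbers c, K with c ≥ K ≥ 1, the function w(t) = tanh((c/2)·(2·artanh(t))^{1/K}) satisfies w(t) ≤ max{1, d^{1/K}}·t^{1/K}, where d = 2·(c/2)^K. -/
/-- The inverse hyperbolic tangent on `(-1, 1)`: `artanh t = (1/2) log((1+t)/(1-t))`. -/
noncomputable def artanh (t : ℝ) : ℝ := (1 / 2) * Real.log ((1 + t) / (1 - t))

theorem Real.hasDerivAt_tanh (x : ℝ) : HasDerivAt Real.tanh (1 / Real.cosh x ^ 2) x := by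
  have h := (Real.hasDerivAt_sinh x).div (Real.hasDerivAt_cosh x) (Real.cosh_pos x).ne'
  have hfun : Real.tanh = Real.sinh / Real.cosh :=
    funext fun y => Real.tanh_eq_sinh_div_cosh y
  rwa [← sq, ← sq, Real.cosh_sq_sub_sinh_sq, ← hfun] at h

theorem Real.monotone_tanh : Monotone Real.tanh :=
  monotone_of_deriv_nonneg (fun x => (Real.hasDerivAt_tanh x).differentiableAt) fun x => by
    rw [(Real.hasDerivAt_tanh x).deriv]
    positivity

theorem Real.tanh_le_self {x : ℝ} (hx : 0 ≤ x) : Real.tanh x ≤ x := by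
  have hd (y : ℝ) : HasDerivAt (fun z => z - Real.tanh z) (1 - 1 / Real.cosh y ^ 2) y :=
    (hasDerivAt_id y).sub (Real.hasDerivAt_tanh y)
  have hm : Monotone fun z => z - Real.tanh z :=
    monotone_of_deriv_nonneg (fun y => (hd y).differentiableAt) fun y => by
      rw [(hd y).deriv, sub_nonneg]
      exact div_le_one_of_le₀ (one_le_pow₀ (Real.one_le_cosh y)) (by positivity)
  simpa using hm hx

theorem Real.tanh_mul_le_mul_tanh {a x : ℝ} (ha : 1 ≤ a) (hx : 0 ≤ x) :
    Real.tanh (a * x) ≤ a * Real.tanh x := by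
  have hd (y : ℝ) : HasDerivAt (fun z => a * Real.tanh z - Real.tanh (a * z))
      (a * (1 / Real.cosh y ^ 2) - 1 / Real.cosh (a * y) ^ 2 * a) y := by
    have h := (hasDerivAt_id y).const_mul a
    rw [mul_one] at h
    exact ((Real.hasDerivAt_tanh y).const_mul a).sub ((Real.hasDerivAt_tanh (a * y)).comp y h)
  have hm : MonotoneOn (fun z => a * Real.tanh z - Real.tanh (a * z)) (Set.Ici 0) := by
    refine monotoneOn_of_deriv_nonneg (convex_Ici 0)
      (fun y _ => (hd y).continuousAt.continuousWithinAt)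
      (fun y _ => (hd y).differentiableAt.differentiableWithinAt) fun y hy => ?_
    rw [interior_Ici, Set.mem_Ioi] at hy
    have hle : Real.cosh y ≤ Real.cosh (a * y) := by
      rw [Real.cosh_le_cosh, abs_of_pos hy, abs_of_pos (by positivity)]
      exact le_mul_of_one_le_left hy.le ha
    rw [(hd y).deriv, mul_comm _ a, sub_nonneg]
    have := Real.cosh_pos y
    gcongr
  simpa using hm Set.self_mem_Ici (Set.mem_Ici.2 hx) hx

theorem Real.tanh_rpow_le {x p : ℝ} (hx : 0 < x) (hp1 : p ≤ 1) :
    Real.tanh (x ^ p) ≤ Real.tanh x ^ p := by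
  have ht0 : 0 ≤ Real.tanh x := by simpa using Real.monotone_tanh hx.le
  rcases le_total x 1 with h | h
  · have hxp : x ≤ x ^ p := Real.self_le_rpow_of_le_one hx.le h hp1
    calc Real.tanh (x ^ p) = Real.tanh (x ^ p / x * x) := by rw [div_mul_cancel₀ _ hx.ne']
      _ ≤ x ^ p / x * Real.tanh x := Real.tanh_mul_le_mul_tanh ((one_le_div hx).2 hxp) hx.le
      _ = x ^ p * (Real.tanh x / x) := by ring
      _ ≤ x ^ p * (Real.tanh x / x) ^ p := by
        gcongr
        exact Real.self_le_rpow_of_le_one (by positivity)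
          (div_le_one_of_le₀ (Real.tanh_le_self hx.le) hx.le) hp1
      _ = Real.tanh x ^ p := by
        rw [← Real.mul_rpow hx.le (by positivity), mul_div_cancel₀ _ hx.ne']
  · exact (Real.monotone_tanh (Real.rpow_le_self_of_one_le h hp1)).trans
      (Real.self_le_rpow_of_le_one ht0 (Real.tanh_lt_one x).le hp1)

theorem one_le_half_mul_two_rpow {K : ℝ} (hK : 1 ≤ K) : 1 ≤ K / 2 * 2 ^ (1 / K) := by
  have hK0 : 0 < K := by linarith
  have hp1 : 1 / K ≤ 1 := div_le_one_of_le₀ hK hK0.le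
  have hb := rpow_one_add_le_one_add_mul_self (s := 1) (by norm_num)
    (sub_nonneg.2 hp1) (sub_le_self 1 (one_div_pos.2 hK0).le)
  rw [one_add_one_eq_two, Real.rpow_sub two_pos, Real.rpow_one] at hb
  have hinv : 1 + (1 - 1 / K) * 1 ≤ K := by
    have : K - (1 + (1 - 1 / K) * 1) = (K - 1) ^ 2 / K := by
      field_simp
      ring
    linarith [div_nonneg (sq_nonneg (K - 1)) hK0.le]
  have h2 : (0 : ℝ) < 2 ^ (1 / K) := by positivity
  have := (div_le_iff₀ h2).1 (hb.trans hinv)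
  linarith

theorem stmt_17 (t c K : ℝ) (ht : t ∈ Set.Ioo (0 : ℝ) 1) (hK : 1 ≤ K) (hc : K ≤ c) :
    Real.tanh ((c / 2) * (2 * artanh t) ^ (1 / K)) ≤
      max 1 ((2 * (c / 2) ^ K) ^ (1 / K)) * t ^ (1 / K) := by
  have hK0 : 0 < K := by linarith
  have hc0 : 0 < c := by linarith
  have hart : artanh t = Real.artanh t :=
    (Real.artanh_eq_half_log ⟨by linarith [ht.1], ht.2.le⟩).symm
  have hx : 0 < artanh t := hart ▸ Real.artanh_pos ht
  have htanh : Real.tanh (artanh t) = t :=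
    hart ▸ Real.tanh_artanh ⟨by linarith [ht.1], ht.2⟩
  have hd : (2 * (c / 2) ^ K) ^ (1 / K) = c / 2 * 2 ^ (1 / K) := by
    rw [Real.mul_rpow two_pos.le (by positivity), ← Real.rpow_mul (by positivity),
      mul_one_div_cancel hK0.ne', Real.rpow_one, mul_comm]
  have hm : 1 ≤ c / 2 * 2 ^ (1 / K) := (one_le_half_mul_two_rpow hK).trans (by gcongr)
  rw [hd, max_eq_right hm, Real.mul_rpow two_pos.le hx.le, ← mul_assoc]
  refine (Real.tanh_mul_le_mul_tanh hm (by positivity)).trans ?_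
  gcongr
  simpa only [htanh] using
    Real.tanh_rpow_le hx (div_le_one_of_le₀ hK hK0.le)
end
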